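/- For every natural number M, one has 0 < ∑_{m=M+1}^{∞} B_m ≤ 1/(6M+1)², where B_m := 1/(6m+1)² + 1/(6m+2)² − 1/(6m+4)² − 1/(6m+5)² and the series converges. -/

import Mathlib

noncomputable def B (m : ℕ) : ℝ :=
  1 / (6 * (m : ℝ) + 1) ^ 2 + 1 / (6 * (m : ℝ) + 2) ^ 2
    - 1 / (6 * (m : ℝ) + 4) ^ 2 - 1 / (6 * (m : ℝ) + 5) ^ 2

lemma one_div_sq_sub_shift_antitone {a b : ℝ} (ha : 0 < a) (hab : a ≤ b) :
    1 / b ^ 2 - 1 / (b + 3) ^ 2 ≤ 1 / a ^ 2 - 1 / (a + 3) ^ 2 := by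
  have factor : ∀ y : ℝ, 0 < y →
      1 / y ^ 2 - 1 / (y + 3) ^ 2 = 3 / (y * (y + 3)) * (1 / y + 1 / (y + 3)) := by
    intro y hy
    field_simp
    ring
  have hb := ha.trans_le hab
  rw [factor a ha, factor b hb]
  gcongr

lemma B_pos (m : ℕ) : 0 < B m := by
  have h₁ : 1 / (6 * (m : ℝ) + 4) ^ 2 < 1 / (6 * (m : ℝ) + 1) ^ 2 := by
    gcongr
    norm_num
  have h₂ : 1 / (6 * (m : ℝ) + 5) ^ 2 < 1 / (6 * (m : ℝ) + 2) ^ 2 := by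
    gcongr
    norm_num
  unfold B
  linarith

lemma B_succ_le (m : ℕ) :
    B (m + 1) ≤ 1 / (6 * (m : ℝ) + 1) ^ 2 - 1 / (6 * ((m + 1 : ℕ) : ℝ) + 1) ^ 2 := by
  have h₁ := one_div_sq_sub_shift_antitone (a := 6 * (m : ℝ) + 1) (b := 6 * (m : ℝ) + 7)
    (by positivity) (by linarith)
  have h₂ := one_div_sq_sub_shift_antitone (a := 6 * (m : ℝ) + 4) (b := 6 * (m : ℝ) + 8)
    (by positivity) (by linarith)
  unfold B
  push_cast
  ring_nf at h₁ h₂ ⊢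
  linarith

lemma sum_range_B_le (M n : ℕ) :
    ∑ m ∈ Finset.range n, B (M + 1 + m) ≤ 1 / (6 * (M : ℝ) + 1) ^ 2 := by
  have h : ∑ m ∈ Finset.range n, B (M + 1 + m) ≤
      1 / (6 * (M : ℝ) + 1) ^ 2 - 1 / (6 * ((M + n : ℕ) : ℝ) + 1) ^ 2 := by
    induction n with
    | zero => simp
    | succ n ih =>
      rw [Finset.sum_range_succ, add_right_comm M 1 n, ← add_assoc M n 1]
      linarith [B_succ_le (M + n)]
  exact h.trans (sub_le_self _ (by positivity))

lemma summable_B_tail (M : ℕ) : Summable fun m : ℕ => B (M + 1 + m) :=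
  summable_of_sum_range_le (fun _ => (B_pos _).le) (sum_range_B_le M)

theorem B_tail_bounds :
    (Summable fun m : ℕ => B m) ∧
    ∀ M : ℕ, 0 < (∑' m : ℕ, B (M + 1 + m)) ∧
      (∑' m : ℕ, B (M + 1 + m)) ≤ 1 / (6 * (M : ℝ) + 1) ^ 2 := by
  refine ⟨?_, fun M => ⟨?_, ?_⟩⟩
  · rw [← summable_nat_add_iff 1]
    simpa only [zero_add, add_comm] using summable_B_tail 0
  · exact (summable_B_tail M).tsum_pos (fun _ => (B_pos _).le) 0 (B_pos _)
  · exact Real.tsum_le_of_sum_range_le (fun _ => (B_pos _).le) (sum_range_B_le M)
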